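/- The 2-dissection 1/E(q)² = E(q⁸)⁵/(E(q²)⁵E(q^{16})²) + 2q E(q⁴)²E(q^{16})²/(E(q²)⁵E(q⁸)) holds, where E(q) = (q;q)_∞. -/

import Mathlib

open scoped BigOperators

/-- Euler function $E(q) = (q;q)_\infty = \prod_{j\ge1}(1-q^j)$. -/
noncomputable def eulerE (q : ℂ) : ℂ := ∏' j : ℕ, (1 - q * q ^ j)

open Filter Topology

/-- The infinite `q`-shifted factorial `(a; q)_∞`. -/
noncomputable def qPochhammerInf (a q : ℂ) : ℂ := ∏' j : ℕ, (1 - a * q ^ j)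

theorem summable_norm_neg_mul_pow (a : ℂ) {q : ℂ} (hq : ‖q‖ < 1) :
    Summable fun j : ℕ => ‖-(a * q ^ j)‖ := by
  simpa using (summable_geometric_of_lt_one (norm_nonneg _) hq).mul_left ‖a‖

theorem multipliable_one_sub_mul_pow (a : ℂ) {q : ℂ} (hq : ‖q‖ < 1) :
    Multipliable fun j : ℕ => 1 - a * q ^ j := by
  simpa [sub_eq_add_neg] using
    multipliable_one_add_of_summable (summable_norm_neg_mul_pow a hq)

theorem norm_pow_lt_one {q : ℂ} (hq : ‖q‖ < 1) {n : ℕ} (hn : n ≠ 0) : ‖q ^ n‖ < 1 := by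
  rw [norm_pow]
  exact pow_lt_one₀ (norm_nonneg _) hq hn

theorem one_sub_mul_pow_self_ne_zero {q : ℂ} (hq : ‖q‖ < 1) (j : ℕ) : 1 - q * q ^ j ≠ 0 := by
  intro h
  have := norm_pow_lt_one hq j.succ_ne_zero
  rw [pow_succ', ← sub_eq_zero.1 h] at this
  simp at this

theorem eulerE_ne_zero {q : ℂ} (hq : ‖q‖ < 1) : eulerE q ≠ 0 := by
  have := tprod_one_add_ne_zero_of_summable (f := fun j : ℕ => -(q * q ^ j))
    (by simpa [← sub_eq_add_neg] using one_sub_mul_pow_self_ne_zero hq)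
    (summable_norm_neg_mul_pow q hq)
  simpa [eulerE, sub_eq_add_neg] using this

theorem qPochhammerInf_eq_mul_sq (a : ℂ) {q : ℂ} (hq : ‖q‖ < 1) :
    qPochhammerInf a q = qPochhammerInf a (q ^ 2) * qPochhammerInf (a * q) (q ^ 2) := by
  have hq2 := norm_pow_lt_one hq two_ne_zero
  have he : HasProd (fun k : ℕ => 1 - a * q ^ (2 * k)) (qPochhammerInf a (q ^ 2)) := by
    simpa [qPochhammerInf, pow_mul] using (multipliable_one_sub_mul_pow a hq2).hasProd
  have ho : HasProd (fun k : ℕ => 1 - a * q ^ (2 * k + 1)) (qPochhammerInf (a * q) (q ^ 2)) := by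
    have h : (fun k : ℕ => 1 - a * q ^ (2 * k + 1)) = fun k => 1 - a * q * (q ^ 2) ^ k := by
      ext k
      ring
    rw [h]
    exact (multipliable_one_sub_mul_pow (a * q) hq2).hasProd
  exact (HasProd.even_mul_odd (f := fun j : ℕ => 1 - a * q ^ j) he ho).tprod_eq

theorem qPochhammerInf_mul_neg (a : ℂ) {q : ℂ} (hq : ‖q‖ < 1) :
    qPochhammerInf (-a) q * qPochhammerInf a q = qPochhammerInf (a ^ 2) (q ^ 2) := by
  rw [qPochhammerInf, qPochhammerInf, ← (multipliable_one_sub_mul_pow (-a) hq).tprod_mul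
    (multipliable_one_sub_mul_pow a hq), qPochhammerInf]
  congr 1
  ext j
  ring

theorem qPochhammerInf_eq_one_sub_mul (a : ℂ) {q : ℂ} (hq : ‖q‖ < 1) :
    qPochhammerInf a q = (1 - a) * qPochhammerInf (a * q) q := by
  rw [qPochhammerInf, tprod_eq_zero_mul']
  · simp [qPochhammerInf, pow_succ', mul_assoc]
  · simpa [pow_succ', mul_assoc] using multipliable_one_sub_mul_pow (a * q) hq

/-- The finite product `(q; q)_n`. -/
noncomputable def qFactorial (q : ℂ) (n : ℕ) : ℂ := ∏ j ∈ Finset.range n, (1 - q * q ^ j)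

/-- The reciprocal of `(q; q)_k`, extended by zero to negative `k`. -/
noncomputable def qFactorialInv (q : ℂ) (k : ℤ) : ℂ :=
  if k < 0 then 0 else (qFactorial q k.toNat)⁻¹

theorem qFactorial_ne_zero {q : ℂ} (hq : ‖q‖ < 1) (n : ℕ) : qFactorial q n ≠ 0 :=
  Finset.prod_ne_zero_iff.2 fun j _ => one_sub_mul_pow_self_ne_zero hq j

theorem tendsto_qFactorial {q : ℂ} (hq : ‖q‖ < 1) :
    Tendsto (qFactorial q) atTop (𝓝 (eulerE q)) :=
  (multipliable_one_sub_mul_pow q hq).tendsto_prod_tprod_nat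

theorem qFactorialInv_sub_one {q : ℂ} (hq : ‖q‖ < 1) (k : ℤ) :
    qFactorialInv q (k - 1) = (1 - q ^ k) * qFactorialInv q k := by
  rcases lt_trichotomy k 0 with h | rfl | h
  · simp [qFactorialInv, h, show k - 1 < 0 by lia]
  · simp [qFactorialInv]
  · obtain ⟨n, rfl⟩ : ∃ n : ℕ, k = n + 1 := ⟨(k - 1).toNat, by lia⟩
    have h1 := one_sub_mul_pow_self_ne_zero hq n
    have h2 := qFactorial_ne_zero hq n
    have h3 : qFactorial q (n + 1) = qFactorial q n * (1 - q * q ^ n) :=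
      Finset.prod_range_succ ..
    have h4 : (q ^ ((n : ℤ) + 1)) = q * q ^ n := by
      rw [← pow_succ']; exact_mod_cast rfl
    have h5 : ¬ ((n : ℤ) + 1 < 0) := by lia
    have h6 : ((n : ℤ) + 1).toNat = n + 1 := by lia
    simp only [qFactorialInv, add_sub_cancel_right, h4, h5, h6, h3, if_false, Int.toNat_natCast,
      show ¬ ((n : ℤ) < 0) by lia]
    field_simp

theorem tendsto_qFactorialInv {q : ℂ} (hq : ‖q‖ < 1) :
    Tendsto (qFactorialInv q) atTop (𝓝 (eulerE q)⁻¹) := by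
  have h : Tendsto Int.toNat atTop atTop :=
    tendsto_atTop.2 fun n => (eventually_ge_atTop (n : ℤ)).mono fun k hk => by lia
  refine (((tendsto_qFactorial hq).inv₀ (eulerE_ne_zero hq)).comp h).congr' ?_
  filter_upwards [eventually_ge_atTop 0] with k hk
  simp [qFactorialInv, not_lt.2 hk]

theorem exists_norm_qFactorial_le {q : ℂ} (hq : ‖q‖ < 1) : ∃ B, ∀ n, ‖qFactorial q n‖ ≤ B := by
  obtain ⟨B, hB⟩ :=
    (Metric.isBounded_range_of_tendsto _ (tendsto_qFactorial hq)).exists_norm_le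
  exact ⟨B, fun n => hB _ ⟨n, rfl⟩⟩

theorem exists_norm_qFactorialInv_le {q : ℂ} (hq : ‖q‖ < 1) :
    ∃ B, ∀ k, ‖qFactorialInv q k‖ ≤ B := by
  obtain ⟨B, hB⟩ := (Metric.isBounded_range_of_tendsto _
    ((tendsto_qFactorial hq).inv₀ (eulerE_ne_zero hq))).exists_norm_le
  refine ⟨B, fun k => ?_⟩
  unfold qFactorialInv
  split_ifs
  · simpa using (norm_nonneg _).trans (hB _ ⟨0, rfl⟩)
  · exact hB _ ⟨_, rfl⟩

/-- The `k`-th term of the finite Jacobi triple product. -/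
noncomputable def tripleTerm (q z : ℂ) (n m : ℕ) (k : ℤ) : ℂ :=
  qFactorial (q ^ 2) (n + m) * qFactorialInv (q ^ 2) (n - k) * qFactorialInv (q ^ 2) (m + k)
    * (z ^ k * q ^ (k ^ 2))

/-- The product side of the finite Jacobi triple product. -/
noncomputable def tripleProd (q z : ℂ) (n m : ℕ) : ℂ :=
  (∏ j ∈ Finset.range n, (1 - -(z * q) * (q ^ 2) ^ j)) *
    ∏ j ∈ Finset.range m, (1 - -(z⁻¹ * q) * (q ^ 2) ^ j)

theorem tripleTerm_succ {q z : ℂ} (hq : ‖q‖ < 1) (hq0 : q ≠ 0) (hz : z ≠ 0) (n m : ℕ) (k : ℤ) :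
    tripleTerm q z (n + 1) m k =
      tripleTerm q z n m k + z * q * (q ^ 2) ^ n * tripleTerm q z n m (k - 1) := by
  have hq2 := norm_pow_lt_one hq two_ne_zero
  have h1 := qFactorialInv_sub_one hq2 (n + 1 - k)
  have h2 := qFactorialInv_sub_one hq2 (m + k)
  have h3 : qFactorial (q ^ 2) (n + 1 + m) =
      qFactorial (q ^ 2) (n + m) * (1 - q ^ 2 * (q ^ 2) ^ (n + m)) := by
    rw [add_right_comm]; exact Finset.prod_range_succ ..
  rw [show (n : ℤ) + 1 - k - 1 = n - k by ring] at h1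
  have hQ : ∀ e : ℤ, (q ^ 2) ^ e = q ^ (2 * e) := fun e => by rw [zpow_mul]; norm_cast
  have hz' : z * z ^ (k - 1) = z ^ k := by rw [zpow_sub_one₀ hz]; field_simp
  have e1 : q * (q ^ 2) ^ n * q ^ ((k - 1) ^ 2) = q ^ (k ^ 2) * (q ^ 2) ^ ((n : ℤ) + 1 - k) := by
    rw [hQ, ← zpow_natCast (q ^ 2) n, hQ, ← zpow_one_add₀ hq0, ← zpow_add₀ hq0, ← zpow_add₀ hq0]
    congr 1; ring
  have e2 : (q ^ 2) ^ ((n : ℤ) + 1 - k) * (q ^ 2) ^ ((m : ℤ) + k) = q ^ 2 * (q ^ 2) ^ (n + m) := by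
    rw [← zpow_add₀ (pow_ne_zero 2 hq0), ← pow_succ', ← zpow_natCast (q ^ 2) (n + m + 1)]
    congr 1; push_cast; ring
  simp only [tripleTerm, h3, Nat.cast_add, Nat.cast_one, h1,
    show (n : ℤ) - (k - 1) = n + 1 - k by ring, show (m : ℤ) + (k - 1) = m + k - 1 by ring, h2]
  rw [← e2, ← hz']
  linear_combination (-(qFactorial (q ^ 2) (n + m) * qFactorialInv (q ^ 2) (n + 1 - k) *
    (1 - (q ^ 2) ^ ((m : ℤ) + k)) * qFactorialInv (q ^ 2) (m + k) * z * z ^ (k - 1))) * e1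

theorem hasSum_tripleTerm_succ {q z : ℂ} (hq : ‖q‖ < 1) (hq0 : q ≠ 0) (hz : z ≠ 0) {n m : ℕ}
    (h : HasSum (tripleTerm q z n m) (tripleProd q z n m)) :
    HasSum (tripleTerm q z (n + 1) m) (tripleProd q z (n + 1) m) := by
  have hs : HasSum (fun k => tripleTerm q z n m (k - 1)) (tripleProd q z n m) :=
    (Equiv.subRight (1 : ℤ)).hasSum_iff.2 h
  convert h.add (hs.mul_left (z * q * (q ^ 2) ^ n)) using 1
  · exact funext (tripleTerm_succ hq hq0 hz n m)
  · rw [tripleProd, Finset.prod_range_succ, tripleProd]; ring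

theorem hasSum_tripleTerm_symm {q z : ℂ} {n m : ℕ}
    (h : HasSum (tripleTerm q z n m) (tripleProd q z n m)) :
    HasSum (tripleTerm q z⁻¹ m n) (tripleProd q z⁻¹ m n) := by
  convert (Equiv.neg ℤ).hasSum_iff.2 h using 1
  · ext k
    simp only [tripleTerm, Function.comp, Equiv.neg_apply, add_comm m n, inv_zpow', neg_sq,
      sub_neg_eq_add, ← sub_eq_add_neg]
    ring
  · simp [tripleProd, mul_comm]

theorem hasSum_tripleTerm_zero (q z : ℂ) :
    HasSum (tripleTerm q z 0 0) (tripleProd q z 0 0) := by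
  convert hasSum_single (0 : ℤ) ?_ using 1
  · simp [tripleTerm, tripleProd, qFactorial, qFactorialInv]
  · intro k hk
    rcases lt_or_gt_of_ne hk with h | h <;> simp [tripleTerm, qFactorialInv, h]

/-- The finite Jacobi triple product. -/
theorem hasSum_tripleTerm {q z : ℂ} (hq : ‖q‖ < 1) (hq0 : q ≠ 0) (hz : z ≠ 0) (n m : ℕ) :
    HasSum (tripleTerm q z n m) (tripleProd q z n m) := by
  induction n with
  | succ n ih => exact hasSum_tripleTerm_succ hq hq0 hz ih
  | zero =>
    have h : HasSum (tripleTerm q z⁻¹ m 0) (tripleProd q z⁻¹ m 0) := by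
      induction m with
      | zero => exact hasSum_tripleTerm_zero q z⁻¹
      | succ m ih => exact hasSum_tripleTerm_succ hq hq0 (inv_ne_zero hz) ih
    simpa using hasSum_tripleTerm_symm h

theorem summable_pow_mul_pow_sq (z : ℂ) {q : ℂ} (hq : ‖q‖ < 1) :
    Summable fun n : ℕ => z ^ n * q ^ (n ^ 2) := by
  have h : Tendsto (fun n : ℕ => ‖z * q ^ n‖) atTop (𝓝 0) := by
    simpa using ((tendsto_pow_atTop_nhds_zero_of_norm_lt_one hq).const_mul z).norm
  refine Summable.of_norm_bounded_eventually_nat (g := fun n => (1 / 2 : ℝ) ^ n)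
    summable_geometric_two ?_
  filter_upwards [h.eventually_le_const (show (0 : ℝ) < 1 / 2 by norm_num)] with n hn
  rw [sq, pow_mul, ← mul_pow, norm_pow]
  exact pow_le_pow_left₀ (norm_nonneg _) hn n

theorem summable_zpow_mul_zpow_sq (z : ℂ) {q : ℂ} (hq : ‖q‖ < 1) :
    Summable fun k : ℤ => z ^ k * q ^ (k ^ 2) := by
  refine Summable.of_nat_of_neg ?_ ?_
  · refine (summable_pow_mul_pow_sq z hq).congr fun n => ?_
    rw [zpow_natCast, ← Nat.cast_pow, zpow_natCast]
  · refine (summable_pow_mul_pow_sq z⁻¹ hq).congr fun n => ?_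
    rw [neg_sq, zpow_neg, ← inv_zpow, zpow_natCast, ← Nat.cast_pow, zpow_natCast]

/-- The Jacobi triple product. -/
theorem jacobi_triple_product {q z : ℂ} (hq : ‖q‖ < 1) (hq0 : q ≠ 0) (hz : z ≠ 0) :
    qPochhammerInf (-(z * q)) (q ^ 2) * qPochhammerInf (-(z⁻¹ * q)) (q ^ 2) * eulerE (q ^ 2) =
      ∑' k : ℤ, z ^ k * q ^ (k ^ 2) := by
  have hq2 := norm_pow_lt_one hq two_ne_zero
  have hE := eulerE_ne_zero hq2
  have hprod : Tendsto (fun n => tripleProd q z n n) atTop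
      (𝓝 (qPochhammerInf (-(z * q)) (q ^ 2) * qPochhammerInf (-(z⁻¹ * q)) (q ^ 2))) :=
    (multipliable_one_sub_mul_pow _ hq2).tendsto_prod_tprod_nat.mul
      (multipliable_one_sub_mul_pow _ hq2).tendsto_prod_tprod_nat
  obtain ⟨A, hA⟩ := exists_norm_qFactorial_le hq2
  obtain ⟨B, hB⟩ := exists_norm_qFactorialInv_le hq2
  have hA0 : 0 ≤ A := (norm_nonneg _).trans (hA 0)
  have hB0 : 0 ≤ B := (norm_nonneg _).trans (hB 0)
  have hsum : Tendsto (fun n : ℕ => ∑' k, tripleTerm q z n n k) atTop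
      (𝓝 (∑' k : ℤ, (eulerE (q ^ 2))⁻¹ * (z ^ k * q ^ (k ^ 2)))) := by
    refine tendsto_tsum_of_dominated_convergence
      ((summable_zpow_mul_zpow_sq z hq).norm.mul_left (A * B * B)) (fun k => ?_)
      (Eventually.of_forall fun n k => ?_)
    · have h1 : Tendsto (fun n : ℕ => qFactorial (q ^ 2) (n + n)) atTop (𝓝 (eulerE (q ^ 2))) :=
        (tendsto_qFactorial hq2).comp (tendsto_id.atTop_add_atTop tendsto_id)
      have h2 : Tendsto (fun n : ℕ => qFactorialInv (q ^ 2) (n - k)) atTop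
          (𝓝 (eulerE (q ^ 2))⁻¹) :=
        (tendsto_qFactorialInv hq2).comp
          (tendsto_atTop_add_const_right _ (-k) tendsto_natCast_atTop_atTop)
      have h3 : Tendsto (fun n : ℕ => qFactorialInv (q ^ 2) (n + k)) atTop
          (𝓝 (eulerE (q ^ 2))⁻¹) :=
        (tendsto_qFactorialInv hq2).comp
          (tendsto_atTop_add_const_right _ k tendsto_natCast_atTop_atTop)
      have h := ((h1.mul h2).mul h3).mul_const (z ^ k * q ^ (k ^ 2))
      rwa [mul_inv_cancel₀ hE, one_mul] at h
    · rw [tripleTerm, norm_mul, norm_mul, norm_mul]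
      gcongr
      exacts [hA _, hB _, hB _]
  have h := tendsto_nhds_unique hprod
    (hsum.congr fun n => (hasSum_tripleTerm hq hq0 hz n n).tsum_eq)
  rw [h, tsum_mul_left]
  field_simp

theorem eulerE_eq_mul_eulerE_sq {q : ℂ} (hq : ‖q‖ < 1) :
    eulerE q = qPochhammerInf q (q ^ 2) * eulerE (q ^ 2) := by
  have h := qPochhammerInf_eq_mul_sq q hq
  rwa [← sq] at h

/-- The product formula for Ramanujan's theta function `φ`. -/
theorem tsum_zpow_sq {q : ℂ} (hq : ‖q‖ < 1) (hq0 : q ≠ 0) :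
    ∑' k : ℤ, q ^ (k ^ 2) = eulerE (q ^ 2) ^ 5 / (eulerE q ^ 2 * eulerE (q ^ 4) ^ 2) := by
  have hq2 := norm_pow_lt_one hq two_ne_zero
  have h := jacobi_triple_product hq hq0 one_ne_zero
  simp only [inv_one, one_mul, one_zpow] at h
  have h1 := eulerE_eq_mul_eulerE_sq hq
  have h2 := eulerE_eq_mul_eulerE_sq hq2
  have h3 := qPochhammerInf_mul_neg q hq2
  have hE1 := eulerE_ne_zero hq
  have hE4 := eulerE_ne_zero (norm_pow_lt_one hq four_ne_zero)
  rw [← pow_mul] at h2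
  have key : qPochhammerInf (-q) (q ^ 2) * (eulerE q * eulerE (q ^ 4)) = eulerE (q ^ 2) ^ 2 := by
    rw [← pow_mul] at h3
    linear_combination qPochhammerInf (-q) (q ^ 2) * eulerE (q ^ 4) * h1 +
      eulerE (q ^ 2) * eulerE (q ^ 4) * h3 - eulerE (q ^ 2) * h2
  rw [← h, eq_div_iff (by positivity)]
  linear_combination eulerE (q ^ 2) * (qPochhammerInf (-q) (q ^ 2) * (eulerE q * eulerE (q ^ 4)) +
    eulerE (q ^ 2) ^ 2) * key

/-- The product formula for Ramanujan's theta function `ψ`, summed over all integers. -/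
theorem tsum_zpow_mul_zpow_sq {q : ℂ} (hq : ‖q‖ < 1) (hq0 : q ≠ 0) :
    ∑' k : ℤ, q ^ k * q ^ (k ^ 2) = 2 * eulerE (q ^ 4) ^ 2 / eulerE (q ^ 2) := by
  have hq2 := norm_pow_lt_one hq two_ne_zero
  have hE := eulerE_ne_zero hq2
  have h := jacobi_triple_product hq hq0 hq0
  rw [inv_mul_cancel₀ hq0, ← sq, qPochhammerInf_eq_one_sub_mul (-1) hq2, neg_one_mul] at h
  have key : qPochhammerInf (-q ^ 2) (q ^ 2) * eulerE (q ^ 2) = eulerE (q ^ 4) := by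
    have := qPochhammerInf_mul_neg (q ^ 2) hq2
    rwa [← pow_mul] at this
  rw [← h, eq_div_iff hE, ← key]
  ring

theorem hasSum_int_even_add_odd {f : ℤ → ℂ} {a b : ℂ} (he : HasSum (fun k => f (2 * k)) a)
    (ho : HasSum (fun k => f (2 * k + 1)) b) : HasSum f (a + b) := by
  have hinj := mul_right_injective₀ (two_ne_zero' ℤ)
  replace ho := ((add_left_injective 1).comp hinj).hasSum_range_iff.2 ho
  refine (hinj.hasSum_range_iff.2 he).add_isCompl ?_ ho
  simpa [Function.comp_def] using Int.isCompl_even_odd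

/-- The 2-dissection `φ(q) = φ(q⁴) + 2qψ(q⁸)`. -/
theorem tsum_zpow_sq_two_dissection {q : ℂ} (hq : ‖q‖ < 1) (hq0 : q ≠ 0) :
    ∑' k : ℤ, q ^ (k ^ 2) =
      ∑' k : ℤ, (q ^ 4) ^ (k ^ 2) + q * ∑' k : ℤ, (q ^ 4) ^ k * (q ^ 4) ^ (k ^ 2) := by
  have hq4 := norm_pow_lt_one hq four_ne_zero
  have hQ : ∀ e : ℤ, (q ^ 4) ^ e = q ^ (4 * e) := fun e => by rw [zpow_mul]; norm_cast
  have he : HasSum (fun k : ℤ => q ^ ((2 * k) ^ 2)) (∑' k : ℤ, (q ^ 4) ^ (k ^ 2)) := by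
    have h : (fun k : ℤ => q ^ ((2 * k) ^ 2)) = fun k => (q ^ 4) ^ (k ^ 2) := by
      ext k
      rw [hQ]
      congr 1; ring
    rw [h]
    simpa using (summable_zpow_mul_zpow_sq 1 hq4).hasSum
  have ho : HasSum (fun k : ℤ => q ^ ((2 * k + 1) ^ 2))
      (q * ∑' k : ℤ, (q ^ 4) ^ k * (q ^ 4) ^ (k ^ 2)) := by
    have h : (fun k : ℤ => q ^ ((2 * k + 1) ^ 2)) =
        fun k => q * ((q ^ 4) ^ k * (q ^ 4) ^ (k ^ 2)) := by
      ext k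
      rw [hQ, hQ, ← zpow_add₀ hq0, ← zpow_one_add₀ hq0]
      congr 1; ring
    rw [h]
    exact (summable_zpow_mul_zpow_sq (q ^ 4) hq4).hasSum.mul_left q
  exact (hasSum_int_even_add_odd (f := fun k : ℤ => q ^ (k ^ 2)) he ho).tsum_eq

/-- The 2-dissection
$1/E(q)^2 = \frac{E(q^8)^5}{E(q^2)^5E(q^{16})^2}
 + \frac{2qE(q^4)^2E(q^{16})^2}{E(q^2)^5E(q^8)}$. -/
theorem two_dissection_recip_sq (q : ℂ) (hq : ‖q‖ < 1) :
    (eulerE q ^ 2)⁻¹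
      = eulerE (q ^ 8) ^ 5 / (eulerE (q ^ 2) ^ 5 * eulerE (q ^ 16) ^ 2)
        + 2 * q * eulerE (q ^ 4) ^ 2 * eulerE (q ^ 16) ^ 2 /
            (eulerE (q ^ 2) ^ 5 * eulerE (q ^ 8)) := by
  rcases eq_or_ne q 0 with rfl | hq0
  · simp [eulerE]
  have hE : ∀ n : ℕ, n ≠ 0 → eulerE (q ^ n) ≠ 0 := fun n hn =>
    eulerE_ne_zero (norm_pow_lt_one hq hn)
  have hE1 := eulerE_ne_zero hq
  have hE2 := hE 2 (by norm_num)
  have hE4 := hE 4 (by norm_num)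
  have hE8 := hE 8 (by norm_num)
  have hE16 := hE 16 (by norm_num)
  have hq4 := norm_pow_lt_one hq four_ne_zero
  have h := tsum_zpow_sq_two_dissection hq hq0
  rw [tsum_zpow_sq hq hq0, tsum_zpow_sq hq4 (pow_ne_zero 4 hq0),
    tsum_zpow_mul_zpow_sq hq4 (pow_ne_zero 4 hq0)] at h
  simp only [← pow_mul, Nat.reduceMul] at h
  field_simp at h ⊢
  linear_combination h
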